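/- arXiv:2310.00306 — 2 statements merged into one kernel-verified Lean document; each statement's English description precedes it below -/
import Mathlib

section
/- If ν is of finite variation, g, h : S → X are |RL| ν-integrable on S, and sup_{s∈S} ‖g(s) − h(s)‖ < ∞, then ‖(|RL|)∫_S g dν − (|RL|)∫_S h dν‖ ≤ sup_{s∈S} ‖g(s) − h(s)‖ · ν̄(S). -/
open Filter Topology

/-- A countable partition of `E` (indexed by `ℕ`): pairwise disjoint measurable sets whose
union is `E`.  Sets are allowed to be empty so that finite partitions are also included;
since `ν ∅ = 0`, empty pieces contribute nothing to the Riemann–Lebesgue sums. -/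
def IsCtblePartition {S : Type*} [MeasurableSpace S] (E : Set S) (A : ℕ → Set S) : Prop :=
  (∀ n, MeasurableSet (A n)) ∧ Pairwise (Function.onFun Disjoint A) ∧ (⋃ n, A n) = E

/-- `P'` is finer than `P`: every set of `P'` is included in some set of `P`. -/
def FinerThan {S : Type*} (P P' : ℕ → Set S) : Prop := ∀ n, ∃ m, P' n ⊆ P m

/-- `t` is a choice of tags for the partition `P` : `t n ∈ P n` whenever `P n ≠ ∅`. -/
def AreTags {S : Type*} (P : ℕ → Set S) (t : ℕ → S) : Prop := ∀ n, (P n).Nonempty → t n ∈ P n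

/-- `h : S → X` is absolutely Riemann–Lebesgue `ν`-integrable on `E` with integral `a`:
for every `ε > 0` there is a countable partition `P₀` of `E` such that for every finer
countable partition `P = {A_n}` of `E`, `h` is bounded on every `A_n` with `ν (A_n) > 0`,
and for every choice of tags `s_n ∈ A_n` the series `Σ_n h (s_n) • ν (A_n)` converges
absolutely with `‖Σ_n h (s_n) • ν (A_n) - a‖ < ε`. -/
def AbsRL {S : Type*} [MeasurableSpace S] {X : Type*} [NormedAddCommGroup X] [NormedSpace ℝ X]
    (ν : Set S → ℝ) (h : S → X) (E : Set S) (a : X) : Prop :=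
  ∀ ε > 0, ∃ P₀ : ℕ → Set S, IsCtblePartition E P₀ ∧
    ∀ P : ℕ → Set S, IsCtblePartition E P → FinerThan P₀ P →
      (∀ n, 0 < ν (P n) → ∃ M, ∀ s ∈ P n, ‖h s‖ ≤ M) ∧
      ∀ t : ℕ → S, AreTags P t →
        Summable (fun n => ‖ν (P n) • h (t n)‖) ∧
        ‖(∑' n, ν (P n) • h (t n)) - a‖ < ε

/-- `h : S → X` is (unconditionally) Riemann–Lebesgue `ν`-integrable on `E` with integral `a`:
as `AbsRL`, but the series is only required to converge unconditionally. -/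
def RL {S : Type*} [MeasurableSpace S] {X : Type*} [NormedAddCommGroup X] [NormedSpace ℝ X]
    (ν : Set S → ℝ) (h : S → X) (E : Set S) (a : X) : Prop :=
  ∀ ε > 0, ∃ P₀ : ℕ → Set S, IsCtblePartition E P₀ ∧
    ∀ P : ℕ → Set S, IsCtblePartition E P → FinerThan P₀ P →
      (∀ n, 0 < ν (P n) → ∃ M, ∀ s ∈ P n, ‖h s‖ ≤ M) ∧
      ∀ t : ℕ → S, AreTags P t →
        Summable (fun n => ν (P n) • h (t n)) ∧
        ‖(∑' n, ν (P n) • h (t n)) - a‖ < ε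

/-- `h` is Birkhoff simple `ν`-integrable on `E` with integral `b`. -/
def BirkhoffSimple {S : Type*} [MeasurableSpace S] {X : Type*} [NormedAddCommGroup X]
    [NormedSpace ℝ X] (ν : Set S → ℝ) (h : S → X) (E : Set S) (b : X) : Prop :=
  ∀ ε > 0, ∃ P₀ : ℕ → Set S, IsCtblePartition E P₀ ∧
    ∀ P : ℕ → Set S, IsCtblePartition E P → FinerThan P₀ P →
      ∀ t : ℕ → S, AreTags P t →
        Filter.limsup (fun n => ‖(∑ k ∈ Finset.range (n + 1), ν (P k) • h (t k)) - b‖)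
          Filter.atTop < ε

/-- The set of all finite sums `Σ_i ν (A_i)` over finite pairwise disjoint families of
measurable sets contained in `E`. -/
def variationSet {S : Type*} [MeasurableSpace S] (ν : Set S → ℝ) (E : Set S) : Set ℝ :=
  { x | ∃ (k : ℕ) (A : Fin k → Set S), (∀ i, MeasurableSet (A i)) ∧ (∀ i, A i ⊆ E) ∧
        Pairwise (Function.onFun Disjoint A) ∧ x = ∑ i, ν (A i) }

/-- The variation `ν̄ (E)` of a set function `ν`. -/
noncomputable def variation {S : Type*} [MeasurableSpace S] (ν : Set S → ℝ) (E : Set S) : ℝ :=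
  sSup (variationSet ν E)

/-- `ν` is of finite variation (on `S`). -/
def FiniteVariation {S : Type*} [MeasurableSpace S] (ν : Set S → ℝ) : Prop :=
  BddAbove (variationSet ν Set.univ)

/-- The semivariation `ν̃ (A) = inf { ν̄ (B) : A ⊆ B, B measurable }`. -/
noncomputable def semivariation {S : Type*} [MeasurableSpace S] (ν : Set S → ℝ)
    (A : Set S) : ℝ :=
  sInf { x | ∃ B : Set S, MeasurableSet B ∧ A ⊆ B ∧ x = variation ν B }

/-- A finite partition of `E`, indexed by `Fin k` (pieces may be empty). -/
def IsFinPartition {S : Type*} [MeasurableSpace S] (E : Set S) {k : ℕ}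
    (A : Fin k → Set S) : Prop :=
  (∀ i, MeasurableSet (A i)) ∧ Pairwise (Function.onFun Disjoint A) ∧ (⋃ i, A i) = E

/-- `h` is Gould `ν`-integrable on `E` with integral `a`. -/
def Gould {S : Type*} [MeasurableSpace S] (ν : Set S → ℝ) (h : S → ℝ) (E : Set S)
    (a : ℝ) : Prop :=
  ∀ ε > 0, ∃ (k : ℕ) (P₀ : Fin k → Set S), IsFinPartition E P₀ ∧
    ∀ (l : ℕ) (P : Fin l → Set S), IsFinPartition E P → (∀ j, ∃ i, P j ⊆ P₀ i) →
      ∀ t : Fin l → S, (∀ j, (P j).Nonempty → t j ∈ P j) →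
        |(∑ j, ν (P j) * h (t j)) - a| < ε

/-- Condition (E) for a set function `μ` (defined at least on the measurable sets). -/
def ConditionE {S : Type*} [MeasurableSpace S] (μ : Set S → ℝ) : Prop :=
  ∀ B : ℕ → ℕ → Set S, (∀ m n, MeasurableSet (B m n)) →
    (∀ m, Antitone fun n => B m n) →
    μ (⋃ m, ⋂ n, B m n) = 0 →
    ∃ np mp : ℕ → ℕ, StrictMono np ∧ StrictMono mp ∧
      Filter.Tendsto (fun k => μ (⋃ p, ⋃ (_ : k ≤ p), B (mp p) (np p)))
        Filter.atTop (nhds 0)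

theorem IsCtblePartition.exists_common_refinement {S : Type*} [MeasurableSpace S] {E : Set S}
    {P Q : ℕ → Set S} (hP : IsCtblePartition E P) (hQ : IsCtblePartition E Q) :
    ∃ R : ℕ → Set S, IsCtblePartition E R ∧ FinerThan P R ∧ FinerThan Q R := by
  obtain ⟨hPm, hPd, hPu⟩ := hP
  obtain ⟨hQm, hQd, hQu⟩ := hQ
  refine ⟨fun n => P n.unpair.1 ∩ Q n.unpair.2,
    ⟨fun n => (hPm _).inter (hQm _), fun m n hmn => ?_, ?_⟩,
    fun n => ⟨_, Set.inter_subset_left⟩, fun n => ⟨_, Set.inter_subset_right⟩⟩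
  · by_cases h₁ : m.unpair.1 = n.unpair.1
    · have h₂ : m.unpair.2 ≠ n.unpair.2 := fun h₂ => hmn <| by
        rw [← Nat.pair_unpair m, ← Nat.pair_unpair n, h₁, h₂]
      exact (hQd h₂).mono Set.inter_subset_right Set.inter_subset_right
    · exact (hPd h₁).mono Set.inter_subset_left Set.inter_subset_left
  · ext x
    constructor
    · intro hx
      obtain ⟨n, hn⟩ := Set.mem_iUnion.1 hx
      exact hPu ▸ Set.mem_iUnion.2 ⟨_, hn.1⟩
    · intro hx
      obtain ⟨i, hi⟩ := Set.mem_iUnion.1 (hPu.symm ▸ hx : x ∈ ⋃ n, P n)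
      obtain ⟨j, hj⟩ := Set.mem_iUnion.1 (hQu.symm ▸ hx : x ∈ ⋃ n, Q n)
      exact Set.mem_iUnion.2 ⟨Nat.pair i j, by simpa using ⟨hi, hj⟩⟩

theorem exists_areTags {S : Type*} [Nonempty S] (P : ℕ → Set S) : ∃ t, AreTags P t := by
  classical
  exact ⟨fun n => if hn : (P n).Nonempty then hn.some else Classical.arbitrary S,
    fun n hn => by simpa only [dif_pos hn] using hn.some_mem⟩

theorem sum_range_le_variation {S : Type*} [MeasurableSpace S] {ν : Set S → ℝ} {E : Set S}
    (hν : BddAbove (variationSet ν E)) {P : ℕ → Set S} (hP : IsCtblePartition E P) (n : ℕ) :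
    ∑ i ∈ Finset.range n, ν (P i) ≤ variation ν E :=
  le_csSup hν ⟨n, fun i => P i, fun i => hP.1 i,
    fun i => hP.2.2 ▸ Set.subset_iUnion P i,
    fun _ _ hij => hP.2.1 (Fin.val_injective.ne hij), Finset.sum_range _⟩

/-- `‖∫ g dν − ∫ h dν‖ ≤ sup_s ‖g s − h s‖ · ν̄(S)`. -/
theorem absRL_dist_le
    {S : Type*} [Nonempty S] [MeasurableSpace S]
    {X : Type*} [NormedAddCommGroup X] [NormedSpace ℝ X] [CompleteSpace X]
    (ν : Set S → ℝ) (hν0 : ν ∅ = 0) (hνnn : ∀ A : Set S, MeasurableSet A → 0 ≤ ν A)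
    (hfv : FiniteVariation ν)
    (g h : S → X) (ag ah : X)
    (hg : AbsRL ν g Set.univ ag) (hh : AbsRL ν h Set.univ ah)
    (hb : ∃ M : ℝ, ∀ s : S, ‖g s - h s‖ ≤ M) :
    ‖ag - ah‖ ≤ (⨆ s : S, ‖g s - h s‖) * variation ν Set.univ := by
  have hbdd : BddAbove (Set.range fun s => ‖g s - h s‖) := by
    obtain ⟨M, hM⟩ := hb
    exact ⟨M, Set.forall_mem_range.2 hM⟩
  have hle : ∀ s, ‖g s - h s‖ ≤ ⨆ s, ‖g s - h s‖ := le_ciSup hbdd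
  have hsup : 0 ≤ ⨆ s, ‖g s - h s‖ := Real.iSup_nonneg fun s => norm_nonneg _
  refine le_of_forall_pos_le_add fun ε hε => ?_
  obtain ⟨P, hP, hgP⟩ := hg (ε / 2) (half_pos hε)
  obtain ⟨Q, hQ, hhQ⟩ := hh (ε / 2) (half_pos hε)
  obtain ⟨R, hR, hPR, hQR⟩ := hP.exists_common_refinement hQ
  obtain ⟨t, ht⟩ := exists_areTags R
  obtain ⟨hgs, hgε⟩ := (hgP R hR hPR).2 t ht
  obtain ⟨hhs, hhε⟩ := (hhQ R hR hQR).2 t ht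
  have hnn : ∀ n, 0 ≤ ν (R n) := fun n => hνnn _ (hR.1 n)
  have hsum : Summable fun n => ν (R n) :=
    summable_of_sum_range_le hnn (sum_range_le_variation hfv hR)
  have htsum : ∑' n, ν (R n) ≤ variation ν Set.univ :=
    Real.tsum_le_of_sum_range_le hnn (sum_range_le_variation hfv hR)
  have hmid : ‖∑' n, ν (R n) • g (t n) - ∑' n, ν (R n) • h (t n)‖
      ≤ (⨆ s, ‖g s - h s‖) * variation ν Set.univ := by
    rw [← hgs.of_norm.tsum_sub hhs.of_norm]
    refine (tsum_of_norm_bounded (hsum.hasSum.mul_left _) fun n => ?_).trans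
      (mul_le_mul_of_nonneg_left htsum hsup)
    rw [← smul_sub, norm_smul, Real.norm_of_nonneg (hnn n), mul_comm]
    exact mul_le_mul_of_nonneg_right (hle _) (hnn n)
  have htri := norm_add₃_le (a := ag - ∑' n, ν (R n) • g (t n))
    (b := ∑' n, ν (R n) • g (t n) - ∑' n, ν (R n) • h (t n))
    (c := ∑' n, ν (R n) • h (t n) - ah)
  rw [sub_add_sub_cancel, sub_add_sub_cancel, norm_sub_rev ag (∑' n, _)] at htri
  linarith
end

section
/- Let ν be of finite variation, and let h, h_n : S → ℝ (n ∈ ℕ) satisfy sup{ |h(s)|, |h_n(s)| : s ∈ S, n ∈ ℕ } < ∞ (so all are |RL| ν-integrable on S). If h_n converges to h in ν̃-measure, i.e. for every δ > 0, lim_{n→∞} ν̃({ s ∈ S : |h_n(s) − h(s)| ≥ δ }) = 0, then lim_{n→∞} (|RL|)∫_S h_n dν = (|RL|)∫_S h dν. -/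
open Filter Topology

/-- The common refinement of two partitions indexed by `ℕ`. -/
def commonRefinement {S : Type*} (A B : ℕ → Set S) (n : ℕ) : Set S :=
  A n.unpair.1 ∩ B n.unpair.2

theorem finerThan_commonRefinement_left {S : Type*} (A B : ℕ → Set S) :
    FinerThan A (commonRefinement A B) :=
  fun n => ⟨n.unpair.1, Set.inter_subset_left⟩

theorem finerThan_commonRefinement_right {S : Type*} (A B : ℕ → Set S) :
    FinerThan B (commonRefinement A B) :=
  fun n => ⟨n.unpair.2, Set.inter_subset_right⟩

theorem FinerThan.trans {S : Type*} {P Q R : ℕ → Set S} (hPQ : FinerThan P Q)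
    (hQR : FinerThan Q R) : FinerThan P R := fun n =>
  let ⟨m, hm⟩ := hQR n
  let ⟨k, hk⟩ := hPQ m
  ⟨k, hm.trans hk⟩

theorem IsCtblePartition.commonRefinement {S : Type*} [MeasurableSpace S] {E : Set S}
    {A B : ℕ → Set S} (hA : IsCtblePartition E A) (hB : IsCtblePartition E B) :
    IsCtblePartition E (commonRefinement A B) := by
  refine ⟨fun n => (hA.1 _).inter (hB.1 _), fun i j hij => ?_, ?_⟩
  · by_cases h₁ : i.unpair.1 = j.unpair.1
    · have h₂ : i.unpair.2 ≠ j.unpair.2 := fun h₂ =>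
        hij (Nat.pairEquiv.symm.injective (Prod.ext h₁ h₂))
      exact (hB.2.1 h₂).mono Set.inter_subset_right Set.inter_subset_right
    · exact (hA.2.1 h₁).mono Set.inter_subset_left Set.inter_subset_left
  · ext x
    simp only [Set.mem_iUnion]
    constructor
    · rintro ⟨n, hn, -⟩
      exact hA.2.2 ▸ Set.mem_iUnion_of_mem _ hn
    · intro hx
      obtain ⟨i, hi⟩ := Set.mem_iUnion.1 (hA.2.2.symm ▸ hx)
      obtain ⟨j, hj⟩ := Set.mem_iUnion.1 (hB.2.2.symm ▸ hx)
      refine ⟨Nat.pair i j, ?_, ?_⟩ <;> simpa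

/-- A measurable set and its complement, followed by empty sets, partition the space. -/
theorem exists_isCtblePartition_of_measurableSet {S : Type*} [MeasurableSpace S] {B : Set S}
    (hB : MeasurableSet B) :
    ∃ A : ℕ → Set S, IsCtblePartition Set.univ A ∧ ∀ n, A n ⊆ B ∨ A n ⊆ Bᶜ := by
  have key : ∀ n : ℕ, ∀ x, x ∈ (if n = 0 then B else if n = 1 then Bᶜ else ∅ : Set S) ↔
      n = 0 ∧ x ∈ B ∨ n = 1 ∧ x ∉ B := by
    intro n x
    split_ifs <;> simp_all
  refine ⟨fun n => if n = 0 then B else if n = 1 then Bᶜ else ∅, ⟨?_, ?_, ?_⟩, ?_⟩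
  · intro n
    dsimp only
    split_ifs
    exacts [hB, hB.compl, MeasurableSet.empty]
  · intro i j hij
    refine Set.disjoint_left.2 fun x hi hj => ?_
    have hi' := (key i x).1 hi
    have hj' := (key j x).1 hj
    grind
  · refine Set.eq_univ_of_forall fun x => Set.mem_iUnion.2 ?_
    by_cases hx : x ∈ B
    · exact ⟨0, (key 0 x).2 (Or.inl ⟨rfl, hx⟩)⟩
    · exact ⟨1, (key 1 x).2 (Or.inr ⟨rfl, hx⟩)⟩
  · intro n
    dsimp only
    split_ifs <;> simp

theorem FiniteVariation.bddAbove {S : Type*} [MeasurableSpace S] {ν : Set S → ℝ}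
    (hν : FiniteVariation ν) (E : Set S) : BddAbove (variationSet ν E) := by
  refine BddAbove.mono ?_ hν
  rintro x ⟨k, A, hA, -, hd, rfl⟩
  exact ⟨k, A, hA, fun i => Set.subset_univ _, hd, rfl⟩

theorem FiniteVariation.sum_range_le_variation {S : Type*} [MeasurableSpace S] {ν : Set S → ℝ}
    (hν : FiniteVariation ν) {E : Set S} {A : ℕ → Set S} (hA : ∀ n, MeasurableSet (A n))
    (hAE : ∀ n, A n ⊆ E) (hd : Pairwise (Function.onFun Disjoint A)) (N : ℕ) :
    ∑ i ∈ Finset.range N, ν (A i) ≤ variation ν E := by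
  refine le_csSup (hν.bddAbove E) ⟨N, fun i => A i, fun i => hA i, fun i => hAE i, ?_, ?_⟩
  · exact fun i j hij => hd (Fin.val_injective.ne hij)
  · exact Finset.sum_range fun i => ν (A i)

theorem exists_variation_lt_of_semivariation_lt {S : Type*} [MeasurableSpace S]
    {ν : Set S → ℝ} {A : Set S} {η : ℝ} (h : semivariation ν A < η) :
    ∃ B, MeasurableSet B ∧ A ⊆ B ∧ variation ν B < η := by
  have hne : {x | ∃ B : Set S, MeasurableSet B ∧ A ⊆ B ∧ x = variation ν B}.Nonempty :=
    ⟨_, Set.univ, MeasurableSet.univ, Set.subset_univ A, rfl⟩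
  obtain ⟨_, ⟨B, hB, hAB, rfl⟩, hlt⟩ := exists_lt_of_csInf_lt hne h
  exact ⟨B, hB, hAB, hlt⟩

/-- Integrals of two uniformly bounded functions that are within `δ` of each other off a
measurable set `B` differ by at most `2 * M * ν̄ (B) + δ * ν̄ (S)`. -/
theorem AbsRL.abs_sub_le_of_dist_le_off {S : Type*} [Nonempty S] [MeasurableSpace S]
    {ν : Set S → ℝ} (hν0 : ν ∅ = 0) (hνnn : ∀ A : Set S, MeasurableSet A → 0 ≤ ν A)
    (hfv : FiniteVariation ν) {f g : S → ℝ} {a b M δ : ℝ}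
    (hf : AbsRL ν f Set.univ a) (hg : AbsRL ν g Set.univ b)
    (hfM : ∀ s, |f s| ≤ M) (hgM : ∀ s, |g s| ≤ M) (hδ : 0 ≤ δ)
    {B : Set S} (hB : MeasurableSet B) (hfg : ∀ s ∉ B, |f s - g s| ≤ δ) :
    |a - b| ≤ 2 * M * variation ν B + δ * variation ν Set.univ := by
  have hM : 0 ≤ M := (abs_nonneg _).trans (hfM (Classical.arbitrary S))
  refine le_of_forall_pos_le_add fun ε hε => ?_
  obtain ⟨P, hP, hPf⟩ := hf (ε / 2) (by positivity)
  obtain ⟨Q, hQ, hQg⟩ := hg (ε / 2) (by positivity)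
  obtain ⟨R, hR, hRB⟩ := exists_isCtblePartition_of_measurableSet hB
  set T := commonRefinement (commonRefinement P Q) R
  have hT : IsCtblePartition Set.univ T := (hP.commonRefinement hQ).commonRefinement hR
  have hTPQ : FinerThan (commonRefinement P Q) T := finerThan_commonRefinement_left _ _
  have hTB : ∀ n, T n ⊆ B ∨ T n ⊆ Bᶜ := fun n =>
    (hRB _).imp Set.inter_subset_right.trans Set.inter_subset_right.trans
  obtain ⟨t, ht⟩ : ∃ t : ℕ → S, AreTags T t := by
    classical
    exact ⟨fun n => if hne : (T n).Nonempty then hne.some else Classical.arbitrary S,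
      fun n hne => by simpa only [dif_pos hne] using hne.some_mem⟩
  obtain ⟨hsf, hlf⟩ := (hPf T hT ((finerThan_commonRefinement_left P Q).trans hTPQ)).2 t ht
  obtain ⟨hsg, hlg⟩ := (hQg T hT ((finerThan_commonRefinement_right P Q).trans hTPQ)).2 t ht
  have hterm : ∀ n, |ν (T n) • f (t n) - ν (T n) • g (t n)| ≤
      2 * M * ν (T n ∩ B) + δ * ν (T n) := by
    intro n
    have hTn := hνnn _ (hT.1 n)
    rw [← smul_sub, smul_eq_mul, abs_mul, abs_of_nonneg hTn]
    rcases (T n).eq_empty_or_nonempty with he | hne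
    · simp [he, hν0]
    · rcases hTB n with hsub | hsub
      · rw [Set.inter_eq_left.2 hsub]
        have := (abs_sub (f (t n)) (g (t n))).trans (add_le_add (hfM _) (hgM _))
        nlinarith [mul_nonneg hδ hTn]
      · have := hfg _ (hsub (ht n hne))
        rw [(Set.disjoint_left.2 hsub).inter_eq, hν0]
        nlinarith
  have hsum : |(∑' n, ν (T n) • f (t n)) - ∑' n, ν (T n) • g (t n)| ≤
      2 * M * variation ν B + δ * variation ν Set.univ := by
    have hs := (hsf.of_norm.hasSum.sub hsg.of_norm.hasSum).tendsto_sum_nat.abs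
    refine le_of_tendsto' hs fun N => ?_
    calc _ ≤ ∑ i ∈ Finset.range N, |ν (T i) • f (t i) - ν (T i) • g (t i)| :=
          Finset.abs_sum_le_sum_abs _ _
      _ ≤ ∑ i ∈ Finset.range N, (2 * M * ν (T i ∩ B) + δ * ν (T i)) :=
          Finset.sum_le_sum fun i _ => hterm i
      _ = 2 * M * ∑ i ∈ Finset.range N, ν (T i ∩ B) + δ * ∑ i ∈ Finset.range N, ν (T i) := by
          rw [Finset.sum_add_distrib, Finset.mul_sum, Finset.mul_sum]
      _ ≤ _ := by
          gcongr
          · exact hfv.sum_range_le_variation (fun n => (hT.1 n).inter hB)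
              (fun n => Set.inter_subset_right)
              (fun i j hij => (hT.2.1 hij).mono Set.inter_subset_left Set.inter_subset_left) N
          · exact hfv.sum_range_le_variation hT.1 (fun n => Set.subset_univ _) hT.2.1 N
  rw [Real.norm_eq_abs, abs_lt] at hlf hlg
  rw [abs_le] at hsum ⊢
  constructor <;> linarith

/-- convergence of the `|RL|` integrals for a uniformly bounded sequence
converging in `ν̃`-measure, `ν` being of finite variation. -/
theorem absRL_tendsto_of_convInSemivariation
    {S : Type*} [Nonempty S] [MeasurableSpace S]
    (ν : Set S → ℝ) (hν0 : ν ∅ = 0) (hνnn : ∀ A : Set S, MeasurableSet A → 0 ≤ ν A)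
    (hfv : FiniteVariation ν)
    (h : S → ℝ) (hn : ℕ → S → ℝ)
    (hb : ∃ M : ℝ, (∀ s : S, |h s| ≤ M) ∧ ∀ (n : ℕ) (s : S), |hn n s| ≤ M)
    (a : ℝ) (an : ℕ → ℝ)
    (hh : AbsRL ν h Set.univ a) (hhn : ∀ n : ℕ, AbsRL ν (hn n) Set.univ (an n))
    (hconv : ∀ δ > (0 : ℝ), Filter.Tendsto
      (fun n => semivariation ν {s : S | δ ≤ |hn n s - h s|}) Filter.atTop (nhds 0)) :
    Filter.Tendsto an Filter.atTop (nhds a) := by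
  obtain ⟨M, hM, hMn⟩ := hb
  have hM0 : 0 ≤ M := (abs_nonneg _).trans (hM (Classical.arbitrary S))
  have hV : 0 ≤ variation ν Set.univ :=
    le_csSup hfv ⟨0, Fin.elim0, fun i => i.elim0, fun i => i.elim0, fun i => i.elim0, by simp⟩
  refine Metric.tendsto_atTop'.2 fun ε hε => ?_
  set δ := ε / (2 * (variation ν Set.univ + 1)) with hδ_def
  set η := ε / (2 * (2 * M + 1)) with hη_def
  have hδ : 0 < δ := by positivity
  have hη : 0 < η := by positivity
  obtain ⟨N, hN⟩ := eventually_atTop.1 ((hconv δ hδ).eventually (gt_mem_nhds hη))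
  refine ⟨N, fun n hNn => ?_⟩
  obtain ⟨B, hB, hsub, hBη⟩ := exists_variation_lt_of_semivariation_lt (hN n hNn.le)
  have hle := (hhn n).abs_sub_le_of_dist_le_off hν0 hνnn hfv hh (hMn n) hM hδ.le hB
    fun s hs => (not_le.1 fun hle => hs (hsub hle)).le
  have hη' : 2 * M * η + η = ε / 2 := by
    rw [hη_def]
    field_simp
  have hδ' : δ * variation ν Set.univ + δ = ε / 2 := by
    rw [hδ_def]
    field_simp
  rw [Real.dist_eq]
  nlinarith [mul_le_mul_of_nonneg_left hBη.le hM0]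
end
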